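/- Let g : ℝⁿ × [0,∞) → ℝⁿ satisfy g(x,0) = x and the semigroup property g(x, s+t) = g(g(x,s), t), suppose t ↦ g(x,t) is continuous and t ↦ ‖g(x,t)‖² is integrable on [0,∞), and let V(y) = ∫₀^∞ ‖g(y,t)‖² dt. Then for every s₀ ≥ 0, the function s ↦ V(g(x,s)) is differentiable at s₀ with derivative −‖g(x,s₀)‖²; in particular the derivative of V along any trajectory is strictly negative at every time where the trajectory is nonzero. -/

import Mathlib

open MeasureTheory Set

/-- The tail integral of a function continuous on `[a, ∞)` and integrable there is differentiable on
`[a, ∞)`, with derivative the negative of the integrand. -/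
theorem hasDerivWithinAt_integral_Ioi {E : Type*} [NormedAddCommGroup E] [NormedSpace ℝ E]
    [CompleteSpace E] {f : ℝ → E} {a s₀ : ℝ} (hf : ContinuousOn f (Ici a))
    (hint : IntegrableOn f (Ioi a)) (hs₀ : a ≤ s₀) :
    HasDerivWithinAt (fun s => ∫ t in Ioi s, f t) (-f s₀) (Ici a) s₀ := by
  have hcont : Continuous fun t => f (max t a) :=
    hf.comp_continuous (by fun_prop) fun t => le_max_right t a
  have hderiv := (hcont.integral_hasStrictDerivAt a s₀).hasDerivAt.const_sub (∫ t in Ioi a, f t)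
  rw [max_eq_left hs₀] at hderiv
  have htail : ∀ s ∈ Ici a,
      ∫ t in Ioi s, f t = (∫ t in Ioi a, f t) - ∫ t in a..s, f (max t a) := by
    intro s hs
    have hext : ∫ t in a..s, f (max t a) = ∫ t in a..s, f t := by
      refine intervalIntegral.integral_congr fun t ht => ?_
      rw [uIcc_of_le hs] at ht
      simp only [max_eq_left ht.1]
    rw [hext, ← intervalIntegral.integral_Ioi_sub_Ioi hint hs, sub_sub_cancel]
  exact hderiv.hasDerivWithinAt.congr htail (htail s₀ hs₀)

/-- For a flow map `g` with `g y 0 = y` and the semigroup property, with `t ↦ g x t`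
continuous and `t ↦ ‖g x t‖²` integrable on `[0, ∞)`, the Lyapunov candidate
`V(y) = ∫₀^∞ ‖g y t‖² dt` is differentiable along the trajectory: for every `s₀ ≥ 0`,
`s ↦ V (g x s)` has derivative `-‖g x s₀‖²` at `s₀` (within the domain `[0, ∞)`);
in particular this derivative is strictly negative whenever `g x s₀ ≠ 0`. -/
theorem lyapunov_derivative_along_trajectory (n : ℕ)
    (g : EuclideanSpace ℝ (Fin n) → ℝ → EuclideanSpace ℝ (Fin n))
    (hg0 : ∀ y, g y 0 = y)
    (hsemi : ∀ y, ∀ s t : ℝ, 0 ≤ s → 0 ≤ t → g y (s + t) = g (g y s) t)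
    (x : EuclideanSpace ℝ (Fin n))
    (hcont : ContinuousOn (fun t => g x t) (Ici (0 : ℝ)))
    (hint : IntegrableOn (fun t => ‖g x t‖ ^ 2) (Ioi (0 : ℝ)))
    (V : EuclideanSpace ℝ (Fin n) → ℝ)
    (hV : ∀ y, V y = ∫ t in Ioi (0 : ℝ), ‖g y t‖ ^ 2) :
    ∀ s₀ : ℝ, 0 ≤ s₀ →
      HasDerivWithinAt (fun s => V (g x s)) (-‖g x s₀‖ ^ 2) (Ici (0 : ℝ)) s₀ ∧
      (g x s₀ ≠ 0 → -‖g x s₀‖ ^ 2 < 0) := by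
  intro s₀ hs₀
  refine ⟨?_, fun h => neg_neg_of_pos (pow_pos (norm_pos_iff.mpr h) 2)⟩
  have hV_tail : ∀ s ∈ Ici (0 : ℝ), V (g x s) = ∫ t in Ioi s, ‖g x t‖ ^ 2 := by
    intro s hs
    have hshift : ∫ t in Ioi (0 : ℝ), ‖g x (s + t)‖ ^ 2 = ∫ t in Ioi s, ‖g x t‖ ^ 2 := by
      have h := ((measurePreserving_add_left volume s).setIntegral_preimage_emb
        (measurableEmbedding_addLeft s) (fun t => ‖g x t‖ ^ 2) (Ioi s))
      simpa using h
    rw [hV, ← hshift]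
    refine setIntegral_congr_fun measurableSet_Ioi fun t ht => ?_
    simp only [hsemi x s t hs (le_of_lt ht)]
  exact (hasDerivWithinAt_integral_Ioi (hcont.norm.pow 2) hint hs₀).congr hV_tail (hV_tail s₀ hs₀)
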